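/- Let G be a discrete group, α: G ↷ Y a continuous action on a compact Hausdorff space, and β: G ↷ A an action by *-automorphisms on a unital C*-algebra A. Assume: (i) α is a G-boundary action (minimal and strongly proximal); (ii) β is uniformly rigid; (iii) there exists an (α,β)-RSP net in G. Then every G-invariant closed *-subalgebra Q with C(Y) ⊆ Q ⊆ C(Y,A) (diagonal G-action, C(Y) embedded as y ↦ g(y)·1_A) splits as a tensor product: there is a G-invariant closed *-subalgebra 𝓑 ⊆ A with Q = {f ∈ C(Y,A) : f(y) ∈ 𝓑 for all y ∈ Y}. -/

import Mathlib

open MeasureTheory Filter Topology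

noncomputable def embedScalar {Y : Type*} (A : Type*) [TopologicalSpace Y] [CStarAlgebra A]
    (g : C(Y, ℂ)) : C(Y, A) :=
  ⟨fun y => g y • (1 : A), g.continuous.smul continuous_const⟩

theorem MonoidHom.starAlgHom_leftInv {G A : Type*} [Group G] [CStarAlgebra A]
    (σ : G →* (A →⋆ₐ[ℂ] A)) (g : G) (a : A) : σ g⁻¹ (σ g a) = a := by
  have h : σ g⁻¹ * σ g = 1 := by rw [← map_mul, inv_mul_cancel, map_one]
  calc σ g⁻¹ (σ g a) = (σ g⁻¹ * σ g) a := rfl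
    _ = a := by rw [h]; rfl

theorem MonoidHom.starAlgHom_continuous {G A : Type*} [Group G] [CStarAlgebra A]
    (σ : G →* (A →⋆ₐ[ℂ] A)) (g : G) : Continuous (σ g) :=
  (NonUnitalStarAlgHom.isometry (σ g)
    (Function.LeftInverse.injective (MonoidHom.starAlgHom_leftInv σ g))).continuous

/-- The diagonal action of `G` on `C(Y,A)`: `(s • f) y = β_s (f (s⁻¹ • y))`. -/
noncomputable def diagAct {G Y A : Type*} [Group G] [TopologicalSpace Y]
    [MulAction G Y] [CStarAlgebra A] (hc : ∀ s : G, Continuous fun y : Y => s • y)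
    (β : G →* (A →⋆ₐ[ℂ] A)) (s : G) (f : C(Y, A)) : C(Y, A) :=
  ⟨fun y => β s (f (s⁻¹ • y)),
    (MonoidHom.starAlgHom_continuous β s).comp (f.continuous.comp (hc s⁻¹))⟩

/-- A convex set of continuous functions which has, for every probability measure, an element of
small integral, contains a uniformly small element. -/
theorem exists_small_of_convex {Y : Type*} [TopologicalSpace Y] [CompactSpace Y] [T2Space Y]
    [MeasurableSpace Y] [BorelSpace Y] (K : Set C(Y, ℝ)) (hK : Convex ℝ K) (hne : K.Nonempty)
    (ε : ℝ) (hε : 0 < ε)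
    (h : ∀ ν : ProbabilityMeasure Y, ∃ k ∈ K, ∫ y, k y ∂(ν : Measure Y) ≤ ε / 2) :
    ∃ k ∈ K, ∀ y, k y < ε := by
  by_contra hcon
  have hSo : IsOpen {u : C(Y, ℝ) | ∀ y, u y < ε} := by
    have := ContinuousMap.isOpen_setOfPred_mapsTo (X := Y) (Y := ℝ) isCompact_univ
      (isOpen_Iio (a := ε))
    simpa [Set.MapsTo] using this
  have hSc : Convex ℝ {u : C(Y, ℝ) | ∀ y, u y < ε} := by
    intro u hu v hv a b ha hb hab y
    exact convex_Iio ε (hu y) (hv y) ha hb hab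
  have hd : Disjoint {u : C(Y, ℝ) | ∀ y, u y < ε} K := by
    rw [Set.disjoint_left]
    intro u hu hk
    exact hcon ⟨u, hk, hu⟩
  obtain ⟨F, u, hF1, hF2⟩ := geometric_hahn_banach_open hSc hSo hK hd
  have hu0 : 0 < u := by
    have := hF1 0 (fun y => by simpa using hε)
    simpa using this
  have hpos : ∀ v : C(Y, ℝ), (∀ y, 0 ≤ v y) → 0 ≤ F v := by
    intro v hv
    by_contra hneg
    push Not at hneg
    have := hF1 ((-(u / (-F v))) • v) (fun y => by
      have h1 : 0 ≤ (u / (-F v)) * v y :=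
        mul_nonneg (div_nonneg hu0.le (by linarith)) (hv y)
      have h2 : ((-(u / (-F v))) • v) y = -((u / (-F v)) * v y) := by simp
      rw [h2]; linarith)
    rw [map_smul, smul_eq_mul] at this
    have h3 : -(u / -F v) * F v = u := by
      have : F v ≠ 0 := hneg.ne
      field_simp
    linarith
  have hone : 0 < F 1 := by
    obtain ⟨k, hk⟩ := hne
    have h1 := hpos (‖k‖ • 1 - k) (fun y => by
      have := (le_abs_self _).trans (k.norm_coe_le_norm y)
      simpa using this)
    rw [map_sub, map_smul, smul_eq_mul] at h1
    have h2 := hF2 k hk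
    by_contra h3
    push Not at h3
    nlinarith [norm_nonneg k]
  let Λ : CompactlySupportedContinuousMap Y ℝ →ₚ[ℝ] ℝ := PositiveLinearMap.mk₀
    { toFun := fun f => (F 1)⁻¹ * F f.toContinuousMap
      map_add' := fun f g => by
        have : (f + g).toContinuousMap = f.toContinuousMap + g.toContinuousMap := rfl
        rw [this, map_add, mul_add]
      map_smul' := fun c f => by
        have : (c • f).toContinuousMap = c • f.toContinuousMap := rfl
        rw [this, map_smul]
        simp only [smul_eq_mul, RingHom.id_apply]; ring }
    (fun f hf => mul_nonneg (inv_nonneg.2 hone.le) (hpos _ fun y => hf y))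
  have hint : ∀ k : C(Y, ℝ), ∫ y, k y ∂(RealRMK.rieszMeasure Λ) = (F 1)⁻¹ * F k := fun k =>
    RealRMK.integral_rieszMeasure Λ (CompactlySupportedContinuousMap.continuousMapEquiv k)
  have hprob : IsProbabilityMeasure (RealRMK.rieszMeasure Λ) := by
    have h1 := hint 1
    rw [inv_mul_cancel₀ hone.ne'] at h1
    simp only [ContinuousMap.one_apply, integral_const, smul_eq_mul, mul_one] at h1
    refine ⟨?_⟩
    rw [Measure.real] at h1
    exact (ENNReal.toReal_eq_one_iff _).1 h1
  obtain ⟨k, hk, hkle⟩ := h ⟨RealRMK.rieszMeasure Λ, hprob⟩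
  have hkle' : (F 1)⁻¹ * F k ≤ ε / 2 := by rw [← hint k]; exact hkle
  have h1 := hF1 ((ε / 2) • 1) (fun y => by
    have : ((ε / 2) • (1 : C(Y, ℝ))) y = ε / 2 := by simp
    rw [this]; linarith)
  rw [map_smul, smul_eq_mul] at h1
  have h2 := hF2 k hk
  rw [inv_mul_le_iff₀ hone] at hkle'
  linarith

/-- Partition of unity: a closed subalgebra containing the scalars `C(Y)` contains every function
whose values, taken as constant functions, belong to it. -/
theorem mem_of_const_mem {Y A : Type*} [TopologicalSpace Y] [CompactSpace Y] [T2Space Y]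
    [CStarAlgebra A] (Q : StarSubalgebra ℂ C(Y, A)) (hQclosed : IsClosed (Q : Set C(Y, A)))
    (hQY : ∀ g : C(Y, ℂ), embedScalar A g ∈ Q) (f : C(Y, A))
    (hf : ∀ y, ContinuousMap.const Y (f y) ∈ Q) : f ∈ Q := by
  change f ∈ (Q : Set C(Y, A))
  rw [← hQclosed.closure_eq, Metric.mem_closure_iff]
  intro ε hε
  have hUo : ∀ y : Y, IsOpen {z : Y | dist (f z) (f y) < ε} := fun y =>
    isOpen_lt (f.continuous.dist continuous_const) continuous_const
  obtain ⟨t, ht⟩ := isCompact_univ.elim_finite_subcover (fun y : Y => {z : Y | dist (f z) (f y) < ε})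
    hUo (fun y _ => Set.mem_iUnion.2 ⟨y, by simpa using hε⟩)
  obtain ⟨ρ, hρ⟩ := PartitionOfUnity.exists_isSubordinate (s := Set.univ) isClosed_univ
    (fun y : t => {z : Y | dist (f z) (f y) < ε}) (fun y => hUo y) (by
      intro z hz
      obtain ⟨y, hy, hzy⟩ := Set.mem_iUnion₂.1 (ht hz)
      exact Set.mem_iUnion.2 ⟨⟨y, hy⟩, hzy⟩)
  let c : t → C(Y, ℂ) := fun i => ⟨fun y => ((ρ i y : ℝ) : ℂ), by fun_prop⟩
  refine ⟨∑ i : t, embedScalar A (c i) * ContinuousMap.const Y (f i),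
    sum_mem fun i _ => mul_mem (hQY _) (hf _), ?_⟩
  rw [ContinuousMap.dist_lt_iff hε]
  intro z
  have h1 := ρ.finsum_smul_mem_convex (g := fun (i : t) (_ : Y) => f i)
    (t := Metric.ball (f z) ε) (Set.mem_univ z) (fun i hi => by
      have := hρ i (subset_closure hi)
      rw [Metric.mem_ball, dist_comm]
      exact this) (convex_ball _ _)
  rw [finsum_eq_sum_of_fintype] at h1
  rw [dist_comm, ← Metric.mem_ball]
  convert h1 using 1
  rw [ContinuousMap.sum_apply]
  refine Finset.sum_congr rfl fun i _ => ?_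
  simp [embedScalar, c]

/-- The key step: the constant function with value `f y*` belongs to `Q`. -/
theorem const_mem_of_rsp {G Y A : Type*} [Group G] [TopologicalSpace Y] [CompactSpace Y]
    [T2Space Y] [MeasurableSpace Y] [BorelSpace Y] [MulAction G Y]
    (hc : ∀ s : G, Continuous fun y : Y => s • y)
    [CStarAlgebra A] (β : G →* (A →⋆ₐ[ℂ] A)) (l : Filter G) (hl : l.NeBot)
    (hβ : ∀ a : A, Filter.Tendsto (fun s : G => ‖β s a - a‖) l (𝓝 0)) (ystar : Y)
    (hν : ∀ ν : ProbabilityMeasure Y,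
        Filter.Tendsto (fun s : G => ν.map (hc s).measurable.aemeasurable) l
          (𝓝 (⟨Measure.dirac ystar,
            Measure.dirac.isProbabilityMeasure⟩ : ProbabilityMeasure Y)))
    (Q : StarSubalgebra ℂ C(Y, A)) (hQclosed : IsClosed (Q : Set C(Y, A)))
    (hQinv : ∀ s : G, ∀ f ∈ Q, diagAct hc β s f ∈ Q) (f : C(Y, A)) (hf : f ∈ Q) :
    ContinuousMap.const Y (f ystar) ∈ Q := by
  change _ ∈ (Q : Set C(Y, A))
  rw [← hQclosed.closure_eq, Metric.mem_closure_iff]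
  intro ε hε
  let K : Set C(Y, ℝ) := {u | ∃ q ∈ Q, ∀ y, ‖q y - f ystar‖ ≤ u y}
  have hiso : ∀ (s : G) (a : A), ‖β s a‖ = ‖a‖ := fun s a =>
    NonUnitalStarAlgHom.norm_map (β s)
      (Function.LeftInverse.injective (MonoidHom.starAlgHom_leftInv β s)) a
  have hKc : Convex ℝ K := by
    rintro u ⟨p, hp, hpu⟩ v ⟨q, hq, hqv⟩ a b ha hb hab
    refine ⟨(a : ℂ) • p + (b : ℂ) • q, add_mem (Q.smul_mem hp _) (Q.smul_mem hq _), fun y => ?_⟩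
    have e : ((a : ℂ) • p + (b : ℂ) • q) y - f ystar
        = (a : ℂ) • (p y - f ystar) + (b : ℂ) • (q y - f ystar) := by
      have hab' : (a : ℂ) + (b : ℂ) = 1 := by exact_mod_cast hab
      calc _ = (a : ℂ) • p y + (b : ℂ) • q y - ((a : ℂ) + (b : ℂ)) • f ystar := by
            rw [hab', one_smul]; rfl
        _ = _ := by rw [add_smul, smul_sub, smul_sub]; abel
    rw [e]
    refine (norm_add_le _ _).trans ?_
    rw [norm_smul, norm_smul, Complex.norm_real, Complex.norm_real, Real.norm_of_nonneg ha,
      Real.norm_of_nonneg hb]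
    exact add_le_add (mul_le_mul_of_nonneg_left (hpu y) ha) (mul_le_mul_of_nonneg_left (hqv y) hb)
  have hKne : K.Nonempty :=
    ⟨⟨fun y => ‖f y - f ystar‖, by fun_prop⟩, f, hf, fun y => le_rfl⟩
  obtain ⟨k, ⟨q, hq, hqk⟩, hk⟩ := exists_small_of_convex K hKc hKne ε hε (by
    intro ν
    let H : C(Y, ℝ) := ⟨fun y => ‖f y - f ystar‖, by fun_prop⟩
    have ht := ProbabilityMeasure.tendsto_iff_forall_integral_tendsto.1 (hν ν)
      (BoundedContinuousFunction.mkOfCompact H)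
    have h0 : ∫ y, H y ∂(Measure.dirac ystar) = 0 := by
      rw [integral_dirac' _ _ H.continuous.stronglyMeasurable]
      simp [H]
    have ht' : Tendsto (fun s : G => ∫ y, H (s • y) ∂(ν : Measure Y)) l (𝓝 0) := by
      rw [← h0]
      refine ht.congr fun s => ?_
      exact integral_map (hc s).measurable.aemeasurable H.continuous.aestronglyMeasurable
    obtain ⟨s, hs1, hs2⟩ := ((ht'.eventually (gt_mem_nhds (show (0 : ℝ) < ε / 4 by linarith))).and
      ((hβ (f ystar)).eventually (gt_mem_nhds (show (0 : ℝ) < ε / 4 by linarith)))).exists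
    refine ⟨⟨fun y => H (s • y) + ε / 4, (H.continuous.comp (hc s)).add continuous_const⟩,
      ⟨diagAct hc β s⁻¹ f, hQinv _ _ hf, fun y => ?_⟩, ?_⟩
    · have e1 : diagAct hc β s⁻¹ f y = β s⁻¹ (f (s • y)) := by simp [diagAct]
      have e2 : ‖β s⁻¹ (f ystar) - f ystar‖ = ‖β s (f ystar) - f ystar‖ := by
        rw [← hiso s (β s⁻¹ (f ystar) - f ystar), map_sub]
        have := MonoidHom.starAlgHom_leftInv β s⁻¹ (f ystar)
        rw [inv_inv] at this
        rw [this, norm_sub_rev]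
      have e3 : diagAct hc β s⁻¹ f y - f ystar
          = β s⁻¹ (f (s • y) - f ystar) + (β s⁻¹ (f ystar) - f ystar) := by
        rw [e1, map_sub]; abel
      rw [e3]
      refine (norm_add_le _ _).trans ?_
      rw [hiso, e2]
      exact add_le_add le_rfl hs2.le
    · have hi : Integrable (fun y => H (s • y)) (ν : Measure Y) := by
        have := (BoundedContinuousFunction.mkOfCompact (H.comp ⟨_, hc s⟩)).integrable
          (ν : Measure Y)
        exact this
      change ∫ y, (H (s • y) + ε / 4) ∂(ν : Measure Y) ≤ ε / 2
      rw [integral_add hi (integrable_const _)]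
      simp only [integral_const, probReal_univ, one_smul]
      linarith)
  refine ⟨q, hq, ?_⟩
  rw [ContinuousMap.dist_lt_iff hε]
  intro y
  rw [dist_comm, dist_eq_norm]
  exact (hqk y).trans_lt (hk y)

/- STATEMENT 17: If `α : G ↷ Y` is a boundary action, `β : G ↷ A` is uniformly rigid,
and there exists an `(α,β)`-RSP net (a net of non-identity group elements, encoded by
a nontrivial filter, witnessing the uniform rigidity of `β` and pushing every
probability measure on `Y` to a fixed Dirac measure `δ_{y*}`), then every `G`-invariant
closed *-subalgebra `C(Y) ⊆ Q ⊆ C(Y,A)` splits as `C(Y) ⊗min 𝓑`. -/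
theorem splitting_of_boundary_times_uniformlyRigid_Cstar
    {G Y A : Type*} [Group G] [TopologicalSpace Y] [CompactSpace Y] [T2Space Y]
    [MeasurableSpace Y] [BorelSpace Y] [MulAction G Y]
    (hc : ∀ s : G, Continuous fun y : Y => s • y)
    [CStarAlgebra A] (β : G →* (A →⋆ₐ[ℂ] A))
    -- (i) `G ↷ Y` is a boundary action: minimal and strongly proximal
    (hYmin : ∀ y : Y, Dense {y' : Y | ∃ s : G, y' = s • y})
    (hYprox : ∀ ν : ProbabilityMeasure Y, ∃ y : Y,
      (⟨Measure.dirac y, Measure.dirac.isProbabilityMeasure⟩ : ProbabilityMeasure Y) ∈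
        closure {μ : ProbabilityMeasure Y |
          ∃ s : G, μ = ν.map (hc s).measurable.aemeasurable})
    -- (ii) `β : G ↷ A` is uniformly rigid
    (hrigid : ∃ l : Filter G, l.NeBot ∧ {s : G | s ≠ 1} ∈ l ∧
      ∀ a : A, Filter.Tendsto (fun s : G => ‖β s a - a‖) l (𝓝 0))
    -- (iii) there exists an `(α,β)`-RSP net
    (hRSP : ∃ l : Filter G, l.NeBot ∧ {s : G | s ≠ 1} ∈ l ∧
      (∀ a : A, Filter.Tendsto (fun s : G => ‖β s a - a‖) l (𝓝 0)) ∧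
      ∃ ystar : Y, ∀ ν : ProbabilityMeasure Y,
        Filter.Tendsto (fun s : G => ν.map (hc s).measurable.aemeasurable) l
          (𝓝 (⟨Measure.dirac ystar,
            Measure.dirac.isProbabilityMeasure⟩ : ProbabilityMeasure Y)))
    (Q : StarSubalgebra ℂ C(Y, A)) (hQclosed : IsClosed (Q : Set C(Y, A)))
    (hQinv : ∀ s : G, ∀ f ∈ Q, diagAct hc β s f ∈ Q)
    (hQY : ∀ g : C(Y, ℂ), embedScalar A g ∈ Q) :
    ∃ 𝓑 : StarSubalgebra ℂ A, IsClosed (𝓑 : Set A) ∧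
      (∀ s : G, ∀ b ∈ 𝓑, β s b ∈ 𝓑) ∧
      (Q : Set C(Y, A)) = {f : C(Y, A) | ∀ y : Y, f y ∈ 𝓑} := by
  obtain ⟨l, hl, -, hβ, ystar, hν⟩ := hRSP
  have key := const_mem_of_rsp hc β l hl hβ ystar hν Q hQclosed hQinv
  let 𝓑 : StarSubalgebra ℂ A :=
    { carrier := {a | ContinuousMap.const Y a ∈ Q}
      mul_mem' := fun {a b} ha hb => mul_mem (S := StarSubalgebra ℂ C(Y, A)) ha hb
      add_mem' := fun {a b} ha hb => add_mem (S := StarSubalgebra ℂ C(Y, A)) ha hb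
      algebraMap_mem' := fun r => Q.algebraMap_mem r
      star_mem' := fun {a} ha => star_mem (S := StarSubalgebra ℂ C(Y, A)) ha }
  have hB : ∀ a, a ∈ 𝓑 ↔ ContinuousMap.const Y a ∈ Q := fun a => Iff.rfl
  have hBc : IsClosed (𝓑 : Set A) := hQclosed.preimage ContinuousMap.continuous_const'
  have hBi : ∀ s : G, ∀ b ∈ 𝓑, β s b ∈ 𝓑 := fun s b hb => hQinv s _ hb
  refine ⟨𝓑, hBc, hBi, ?_⟩
  ext f
  constructor
  · intro hf y
    have hcl : IsClosed {y | f y ∈ 𝓑} := hBc.preimage f.continuous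
    have hsub : {y' : Y | ∃ s : G, y' = s • ystar} ⊆ {y | f y ∈ 𝓑} := by
      rintro _ ⟨s, rfl⟩
      have h1 := hBi s _ (key _ (hQinv s⁻¹ f hf))
      have h2 : β s (diagAct hc β s⁻¹ f ystar) = f (s • ystar) := by
        have := MonoidHom.starAlgHom_leftInv β s⁻¹ (f (s • ystar))
        simpa [diagAct] using this
      rw [h2] at h1
      exact h1
    exact hcl.closure_subset_iff.2 hsub (hYmin ystar y)
  · intro hf
    exact mem_of_const_mem Q hQclosed hQY f hf
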